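/- arXiv:2205.02425 — 7 statements merged into one kernel-verified Lean document; each statement's English description precedes it below -/
import Mathlib

section
/- (Parallel chase step preserves weak orthogonality.) Let 𝒞 be a category with coproducts indexed by a type ι, let h_i : X_i ⟶ B_i (i : ι) be a family of morphisms, let I be an object, and let f_i : X_i ⟶ I be a family of morphisms. Form the pushout of the coproduct morphism ∐_i h_i : ∐_i X_i ⟶ ∐_i B_i along the copairing [f_i] : ∐_i X_i ⟶ I, with pushout object P and morphism c : I ⟶ P. Let A be an object such that for every i, every morphism u : X_i ⟶ A factors through h_i. Then every morphism a : I ⟶ A factors through c: there exists a' : P ⟶ A with a' ∘ c = a. -/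
open CategoryTheory Limits

/-- Parallel chase step preserves weak orthogonality. -/
theorem stmt_4 {𝒞 : Type*} [Category 𝒞] {ι : Type*}
    [HasColimitsOfShape (Discrete ι) 𝒞]
    {X B : ι → 𝒞} (h : ∀ i, X i ⟶ B i) {I P A : 𝒞}
    (f : ∀ i, X i ⟶ I) (c : I ⟶ P) (g : (∐ B) ⟶ P)
    (hpo : IsPushout (Sigma.desc f) (Limits.Sigma.map h) c g)
    (hA : ∀ (i : ι) (u : X i ⟶ A), ∃ v : B i ⟶ A, h i ≫ v = u) :
    ∀ a : I ⟶ A, ∃ a' : P ⟶ A, c ≫ a' = a := by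
  intro a
  choose v hv using fun i => hA i (f i ≫ a)
  exact ⟨hpo.desc a (Sigma.desc v) (by ext i; simp [hv]), hpo.inl_desc _ _ _⟩
end

section
/- (Parallel chase step on a cartesian theory preserves orthogonality.) Let 𝒞 be a category with coproducts indexed by a type ι, let h_i : X_i ⟶ B_i (i : ι) be a family of morphisms, let I be an object, and let f_i : X_i ⟶ I be a family of morphisms. Form the pushout of ∐_i h_i : ∐_i X_i ⟶ ∐_i B_i along the copairing [f_i] : ∐_i X_i ⟶ I, with pushout object P and morphism c : I ⟶ P. Let A be an object such that for every i, every morphism u : X_i ⟶ A factors uniquely through h_i. Then every morphism a : I ⟶ A factors uniquely through c: there exists a unique a' : P ⟶ A with a' ∘ c = a. -/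
open CategoryTheory Limits

/-- Parallel chase step on a cartesian theory preserves orthogonality. -/
theorem stmt_5 {𝒞 : Type*} [Category 𝒞] {ι : Type*}
    [HasColimitsOfShape (Discrete ι) 𝒞]
    {X B : ι → 𝒞} (h : ∀ i, X i ⟶ B i) {I P A : 𝒞}
    (f : ∀ i, X i ⟶ I) (c : I ⟶ P) (g : (∐ B) ⟶ P)
    (hpo : IsPushout (Sigma.desc f) (Limits.Sigma.map h) c g)
    (hA : ∀ (i : ι) (u : X i ⟶ A), ∃! v : B i ⟶ A, h i ≫ v = u) :
    ∀ a : I ⟶ A, ∃! a' : P ⟶ A, c ≫ a' = a := by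
  intro a
  choose v hv hv_unique using fun i => hA i (f i ≫ a)
  have comm : Sigma.desc f ≫ a = Limits.Sigma.map h ≫ Sigma.desc v := by
    refine Limits.Sigma.hom_ext _ _ fun i => ?_
    simp [hv i]
  refine ⟨hpo.desc a (Sigma.desc v) comm, hpo.inl_desc _ _ _, fun b hb => ?_⟩
  refine hpo.hom_ext (by rw [hb, hpo.inl_desc]) ?_
  rw [hpo.inr_desc]
  refine Limits.Sigma.hom_ext _ _ fun i => ?_
  rw [Sigma.ι_desc]
  refine hv_unique i _ ?_
  have w := Sigma.ι X i ≫= (hpo.w =≫ b)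
  simpa [hb] using w.symm
end

section
/- Let C be a finite category (finitely many objects and finite hom-sets), let F : ℕ ⥤ (C ⥤ Type) be a sequential diagram of functors, and let ℓ_n : F n ⟶ colim F denote the legs of the colimit cocone. Let A : C ⥤ Type be a functor such that A c is a finite type for every object c of C, and let a : A ⟶ colim F be a natural transformation. Then there exist n : ℕ and a natural transformation a' : A ⟶ F n such that ℓ_n ∘ a' = a. -/
open CategoryTheory Limits

/-- If finitely many properties of natural numbers are each preserved upwards and
satisfiable, then they are satisfied simultaneously by arbitrarily large numbers. -/
theorem exists_nat_ge_forall_of_finite {ι : Type*} [Finite ι] {P : ι → ℕ → Prop}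
    (hP : ∀ i m n, m ≤ n → P i m → P i n) (h : ∀ i, ∃ n, P i n) (N : ℕ) :
    ∃ n, N ≤ n ∧ ∀ i, P i n := by
  choose f hf using h
  obtain ⟨n, hn⟩ := (Set.finite_range f).bddAbove
  exact ⟨max N n, le_max_left N n,
    fun i => hP i _ _ ((hn ⟨i, rfl⟩).trans (le_max_right N n)) (hf i)⟩

/-- A natural transformation from a finite functor into the colimit of a sequence of
functors on a finite category factors through some stage of the sequence. -/
theorem stmt_6 {C : Type} [SmallCategory C] [FinCategory C]
    (F : ℕ ⥤ (C ⥤ Type)) (A : C ⥤ Type) (hA : ∀ c : C, Finite (A.obj c))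
    (a : A ⟶ colimit F) :
    ∃ (n : ℕ) (a' : A ⟶ F.obj n), a' ≫ colimit.ι F n = a := by
  have hc (c : C) : IsColimit (((evaluation C Type).obj c).mapCocone (colimit.cocone F)) :=
    isColimitOfPreserves _ (colimit.isColimit F)
  have hw (m n : ℕ) (h : m ≤ n) (c : C) (y : (F.obj m).obj c) :
      (colimit.ι F n).app c ((F.map (homOfLE h)).app c y) = (colimit.ι F m).app c y := by
    rw [← colimit.w F (homOfLE h)]
    rfl
  have hlift : ∃ n, 0 ≤ n ∧ ∀ p : Σ c, A.obj c,
      ∃ y : (F.obj n).obj p.1, (colimit.ι F n).app p.1 y = a.app p.1 p.2 := by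
    apply exists_nat_ge_forall_of_finite
    · rintro p m n h ⟨y, hy⟩
      exact ⟨(F.map (homOfLE h)).app p.1 y, (hw m n h p.1 y).trans hy⟩
    · intro p
      exact Types.jointly_surjective_of_isColimit (hc p.1) (a.app p.1 p.2)
  obtain ⟨N, -, hN⟩ := hlift
  choose y hy using hN
  have hnat : ∃ n, N ≤ n ∧ ∀ q : Σ (c d : C) (_ : c ⟶ d), A.obj c, ∃ h : N ≤ n,
      (F.map (homOfLE h)).app q.2.1 ((F.obj N).map q.2.2.1 (y ⟨q.1, q.2.2.2⟩)) =
        (F.map (homOfLE h)).app q.2.1 (y ⟨q.2.1, A.map q.2.2.1 q.2.2.2⟩) := by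
    apply exists_nat_ge_forall_of_finite
    · rintro q m n h ⟨hm, e⟩
      refine ⟨hm.trans h, ?_⟩
      have hcomp : F.map (homOfLE (hm.trans h)) = F.map (homOfLE hm) ≫ F.map (homOfLE h) := by
        rw [← F.map_comp]
        rfl
      rw [hcomp]
      exact congrArg ((F.map (homOfLE h)).app q.2.1) e
    · rintro ⟨c, d, f, x⟩
      have e : (colimit.ι F N).app d ((F.obj N).map f (y ⟨c, x⟩)) =
          (colimit.ι F N).app d (y ⟨d, A.map f x⟩) := by
        rw [hy ⟨d, A.map f x⟩, NatTrans.naturality_apply, hy ⟨c, x⟩, NatTrans.naturality_apply]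
      obtain ⟨n, g, hg⟩ := (Types.FilteredColimit.isColimit_eq_iff' (hc d) _ _).1 e
      exact ⟨n, leOfHom g, hg⟩
  obtain ⟨M, h, hM⟩ := hnat
  refine ⟨M, { app := fun c => ↾fun x => (F.map (homOfLE h)).app c (y ⟨c, x⟩),
               naturality := ?_ }, ?_⟩
  · intro c d f
    ext x
    obtain ⟨_, e⟩ := hM ⟨c, d, f, x⟩
    refine e.symm.trans ?_
    exact NatTrans.naturality_apply (F.map (homOfLE h)) f (y ⟨c, x⟩)
  · ext c x
    exact (hw N M h c _).trans (hy ⟨c, x⟩)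
end

section
/- (Fair chase sequences yield models in the colimit.) Let C be a finite category (finitely many objects and finite hom-sets), let F : ℕ ⥤ (C ⥤ Type) be a sequential diagram with colimit colim F and colimit cocone legs ℓ_n : F n ⟶ colim F. Let h : X ⟶ Y be a morphism in C ⥤ Type such that X c is a finite type for every object c of C. Assume the sequence is fair with respect to h: for every n : ℕ and every natural transformation f : X ⟶ F n, there exist m ≥ n and g : Y ⟶ F m such that g ∘ h = F(n ≤ m) ∘ f. Then colim F is weakly orthogonal to h: for every natural transformation f : X ⟶ colim F there exists g : Y ⟶ colim F with g ∘ h = f. -/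
open CategoryTheory Limits

/-- A natural transformation from a pointwise finite functor on a finite category into the colimit
of a sequence factors through some stage of the sequence. -/
theorem exists_hom_of_isColimit_of_finite {C : Type} [SmallCategory C] [FinCategory C]
    {F : ℕ ⥤ (C ⥤ Type)} {s : Cocone F} (hs : IsColimit s) {X : C ⥤ Type}
    (hX : ∀ c : C, Finite (X.obj c)) (f : X ⟶ s.pt) :
    ∃ (n : ℕ) (g : X ⟶ F.obj n), g ≫ s.ι.app n = f := by
  have hc (c : C) := isColimitOfPreserves ((evaluation C Type).obj c) hs
  have surj (p : Σ c, X.obj c) : ∃ (n : ℕ) (y : (F.obj n).obj p.1),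
      (s.ι.app n).app p.1 y = f.app p.1 p.2 :=
    Types.jointly_surjective _ (hc p.1) (f.app p.1 p.2)
  choose n y hy using surj
  obtain ⟨N, hN⟩ := Finite.exists_le n
  let z (c : C) (x : X.obj c) : (F.obj N).obj c := (F.map (homOfLE (hN ⟨c, x⟩))).app c (y ⟨c, x⟩)
  have hz (c : C) (x : X.obj c) : (s.ι.app N).app c (z c x) = f.app c x := by
    rw [← hy ⟨c, x⟩, ← s.w (homOfLE (hN ⟨c, x⟩))]
    rfl
  have compat (p : Σ (c d : C) (_ : c ⟶ d), X.obj c) : ∃ (m : ℕ) (hm : N ≤ m),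
      (F.map (homOfLE hm)).app p.2.1 ((F.obj N).map p.2.2.1 (z p.1 p.2.2.2)) =
        (F.map (homOfLE hm)).app p.2.1 (z p.2.1 (X.map p.2.2.1 p.2.2.2)) := by
    obtain ⟨c, d, φ, x⟩ := p
    obtain ⟨m, i, hi⟩ := (Types.FilteredColimit.isColimit_eq_iff' (hc d)
      ((F.obj N).map φ (z c x)) (z d (X.map φ x))).1 (by
        change (s.ι.app N).app d ((F.obj N).map φ (z c x)) =
          (s.ι.app N).app d (z d (X.map φ x))
        rw [hz, NatTrans.naturality_apply, hz, NatTrans.naturality_apply]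
        rfl)
    exact ⟨m, leOfHom i, hi⟩
  choose m hm hφ using compat
  obtain ⟨M, hM⟩ := Finite.exists_le m
  have hNM : N ≤ max N M := le_max_left N M
  refine ⟨max N M,
    { app c := ↾ fun x => (F.map (homOfLE hNM)).app c (z c x), naturality := ?_ }, ?_⟩
  · intro c d φ
    ext x
    let p : Σ (c d : C) (_ : c ⟶ d), X.obj c := ⟨c, d, φ, x⟩
    have key := congrArg ((F.map (homOfLE ((hM p).trans (le_max_right N M)))).app d) (hφ p)
    have comp (w : (F.obj N).obj d) :
        (F.map (homOfLE ((hM p).trans (le_max_right N M)))).app d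
          ((F.map (homOfLE (hm p))).app d w) = (F.map (homOfLE hNM)).app d w := by
      rw [← homOfLE_comp (hm p) ((hM p).trans (le_max_right N M)), F.map_comp]
      rfl
    exact (((comp _).symm.trans key).trans (comp _)).symm.trans
      (NatTrans.naturality_apply (F.map (homOfLE hNM)) φ (z c x))
  · ext c x
    refine Eq.trans ?_ (hz c x)
    rw [← s.w (homOfLE hNM)]
    rfl

/-- Fair chase sequences yield models in the colimit: if the sequence `F` is fair with
respect to `h : X ⟶ Y` (with `X` pointwise finite), then `colim F` is weakly
orthogonal to `h`. -/
theorem stmt_8 {C : Type} [SmallCategory C] [FinCategory C]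
    (F : ℕ ⥤ (C ⥤ Type)) {X Y : C ⥤ Type} (h : X ⟶ Y)
    (hX : ∀ c : C, Finite (X.obj c))
    (fair : ∀ (n : ℕ) (f : X ⟶ F.obj n), ∃ (m : ℕ) (hnm : n ≤ m) (g : Y ⟶ F.obj m),
      h ≫ g = f ≫ F.map (homOfLE hnm)) :
    ∀ f : X ⟶ colimit F, ∃ g : Y ⟶ colimit F, h ≫ g = f := by
  intro f
  obtain ⟨n, f', rfl⟩ := exists_hom_of_isColimit_of_finite (colimit.isColimit F) hX f
  obtain ⟨m, hnm, g, hg⟩ := fair n f'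
  exact ⟨g ≫ colimit.ι F m, by rw [reassoc_of% hg, colimit.w, colimit.cocone_ι]⟩
end

section
/- (Existence of weakly free models.) Let C be a finite category (finitely many objects and finite hom-sets), let ι be a type, and let h_i : X_i ⟶ Y_i (i : ι) be a family of morphisms in C ⥤ Type such that X_i c is a finite type for every i and every object c of C. Call an object A of C ⥤ Type a model if for every i, every morphism u : X_i ⟶ A factors through h_i. Then for every functor I : C ⥤ Type there exist a model A and a morphism l : I ⟶ A such that for every model B and every morphism b : I ⟶ B there exists g : A ⟶ B with g ∘ l = b. -/
open CategoryTheory Limits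

namespace CategoryTheory

attribute [local instance] Cardinal.fact_isRegular_aleph0 Cardinal.orderBotAleph0OrdToType

variable {C : Type} [SmallCategory C]

/-- The tautological cocone with point `F` on the diagram of corepresentables indexed by the opposite
of the category of elements of `F`. -/
def coconeOfCorepresentables (F : C ⥤ Type) :
    Cocone ((CategoryOfElements.π F).op ⋙ coyoneda) where
  pt := F
  ι :=
    { app x := coyonedaEquiv.symm x.unop.2
      naturality x y f := by
        refine (coyonedaEquiv_symm_map f.unop.1 y.unop.2).symm.trans ?_
        rw [f.unop.2]
        exact (Category.comp_id _).symm }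

/-- The tautological cocone of a functor to types is a colimit cocone. -/
def isColimitCoconeOfCorepresentables (F : C ⥤ Type) :
    IsColimit (coconeOfCorepresentables F) where
  desc s :=
    { app c := ↾fun x ↦ coyonedaEquiv (s.ι.app (Opposite.op (F.elementsMk c x)))
      naturality c d f := by
        ext x
        have := s.w (Quiver.Hom.op (CategoryOfElements.homMk (F.elementsMk c x)
          (F.elementsMk d (F.map f x)) f rfl))
        exact (congrArg coyonedaEquiv this).symm.trans
          (coyonedaEquiv_naturality (s.ι.app (Opposite.op (F.elementsMk c x))) f).symm }
  fac s j := by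
    ext c (f : j.unop.1 ⟶ c)
    let φ : j.unop ⟶ F.elementsMk c (F.map f j.unop.2) := ⟨f, rfl⟩
    have := s.w φ.op
    exact (congrArg coyonedaEquiv this).symm.trans
      ((coyonedaEquiv_naturality (s.ι.app j) f).symm.trans (map_coyonedaEquiv (s.ι.app j) f))
  uniq s m hm := by
    ext c x
    have := congrArg coyonedaEquiv (hm (Opposite.op (F.elementsMk c x)))
    refine Eq.trans ?_ this
    exact congrArg (m.app c) (coyonedaEquiv.apply_symm_apply x).symm

instance isFinitelyPresentable_coyoneda_obj (c : Cᵒᵖ) :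
    IsFinitelyPresentable.{0} (coyoneda.obj c) where
  preservesColimitOfShape _ _ _ :=
    preservesColimitsOfShape_of_natIso (curriedCoyonedaLemma.app c.unop).symm

/-- A pointwise finite functor on a finite category is a finite colimit of corepresentables, hence
finitely presentable. -/
lemma isFinitelyPresentable_of_finite [FinCategory C] (F : C ⥤ Type)
    [∀ c, Finite (F.obj c)] : IsFinitelyPresentable.{0} F := by
  have : Finite F.Elements := inferInstanceAs (Finite (Σ c, F.obj c))
  have (x y : F.Elements) : Finite (x ⟶ y) := inferInstanceAs (Finite (Subtype _))
  have hF : Finite (Arrow F.Elements) :=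
    (Arrow.finite_iff _).2 ⟨Fintype.ofFinite _, fun _ _ ↦ Fintype.ofFinite _⟩
  have (x : F.Elementsᵒᵖ) : IsCardinalPresentable
      (((CategoryOfElements.π F).op ⋙ coyoneda).obj x) Cardinal.aleph0.{0} :=
    isFinitelyPresentable_coyoneda_obj _
  exact isCardinalPresentable_of_isColimit _ (isColimitCoconeOfCorepresentables F) _
    ((hasCardinalLT_arrow_op_iff _ _).2 ((hasCardinalLT_aleph0_iff _).2 hF))

lemma hasSmallObjectArgument_ofHoms_of_isFinitelyPresentable {D : Type*} [Category* D]
    [LocallySmall.{0} D] [HasColimitsOfSize.{0, 0} D]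
    {ι : Type} {X Y : ι → D} (h : ∀ i, X i ⟶ Y i) [∀ i, IsFinitelyPresentable.{0} (X i)] :
    MorphismProperty.HasSmallObjectArgument.{0} (MorphismProperty.ofHoms h) where
  exists_cardinal := ⟨Cardinal.aleph0.{0}, inferInstance, inferInstance,
    { isSmall := MorphismProperty.isSmall_ofHoms ..
      preservesColimit := by
        rintro _ _ _ _ _ ⟨i⟩ f hf
        infer_instance }⟩

lemma exists_rlp_terminal_from_and_llp {D : Type*} [Category* D] [HasTerminal D]
    (W : MorphismProperty D) [MorphismProperty.HasSmallObjectArgument.{0} W] (I : D) :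
    ∃ (A : D) (l : I ⟶ A), W.rlp (terminal.from A) ∧ W.rlp.llp l := by
  let d := MorphismProperty.factorizationData W.rlp.llp W.rlp (terminal.from I)
  exact ⟨d.Z, d.i, by simpa [Subsingleton.elim (terminal.from d.Z) d.p] using d.hp, d.hi⟩

lemma rlp_ofHoms_terminal_from_iff {D : Type*} [Category* D] [HasTerminal D]
    {ι : Type*} {X Y : ι → D} (h : ∀ i, X i ⟶ Y i) (A : D) :
    (MorphismProperty.ofHoms h).rlp (terminal.from A) ↔
      ∀ (i : ι) (u : X i ⟶ A), ∃ v : Y i ⟶ A, h i ≫ v = u := by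
  constructor
  · intro hA i u
    have := hA _ ⟨i⟩
    have sq : CommSq u (h i) (terminal.from A) (terminal.from _) := ⟨Subsingleton.elim _ _⟩
    exact ⟨sq.lift, sq.fac_left⟩
  · rintro hA _ _ _ ⟨i⟩
    refine ⟨fun {u t} sq ↦ ?_⟩
    obtain ⟨v, hv⟩ := hA i u
    exact ⟨⟨⟨v, hv, Subsingleton.elim _ _⟩⟩⟩

end CategoryTheory

/-- Existence of weakly free models: given a family of morphisms `h i : X i ⟶ Y i` in
`C ⥤ Type` with each `X i` pointwise finite, every `I : C ⥤ Type` admits a weakly free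
model, i.e. a model `A` (object weakly orthogonal to every `h i`) with `l : I ⟶ A`
through which every morphism from `I` to a model factors. -/
theorem stmt_9 {C : Type} [SmallCategory C] [FinCategory C]
    {ι : Type} {X Y : ι → (C ⥤ Type)} (h : ∀ i, X i ⟶ Y i)
    (hX : ∀ (i : ι) (c : C), Finite ((X i).obj c))
    (I : C ⥤ Type) :
    ∃ (A : C ⥤ Type) (l : I ⟶ A),
      (∀ (i : ι) (u : X i ⟶ A), ∃ v : Y i ⟶ A, h i ≫ v = u) ∧
      ∀ (B : C ⥤ Type), (∀ (i : ι) (u : X i ⟶ B), ∃ v : Y i ⟶ B, h i ≫ v = u) →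
        ∀ b : I ⟶ B, ∃ g : A ⟶ B, l ≫ g = b := by
  have (i : ι) : IsFinitelyPresentable.{0} (X i) :=
    have := hX i
    isFinitelyPresentable_of_finite (X i)
  have := hasSmallObjectArgument_ofHoms_of_isFinitelyPresentable h
  obtain ⟨A, l, hA, hl⟩ := exists_rlp_terminal_from_and_llp (MorphismProperty.ofHoms h) I
  refine ⟨A, l, (rlp_ofHoms_terminal_from_iff h A).1 hA, fun B hB b ↦ ?_⟩
  have := hl _ ((rlp_ofHoms_terminal_from_iff h B).2 hB)
  have sq : CommSq b l (terminal.from B) (terminal.from A) := ⟨Subsingleton.elim _ _⟩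
  exact ⟨sq.lift, sq.fac_left⟩
end

section
/- (Existence of free models of cartesian theories.) Let C be a finite category (finitely many objects and finite hom-sets), let ι be a type, and let h_i : X_i ⟶ Y_i (i : ι) be a family of morphisms in C ⥤ Type such that X_i c is a finite type for every i and every object c of C. Call an object A of C ⥤ Type a strict model if for every i, every morphism u : X_i ⟶ A factors uniquely through h_i. Then for every functor I : C ⥤ Type there exist a strict model A and a morphism l : I ⟶ A such that for every strict model B and every morphism b : I ⟶ B there exists a unique g : A ⟶ B with g ∘ l = b. -/
open CategoryTheory Limits

universe w v u

/-- The objects of a small family of presentable objects are all `κ`-presentable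
for a common regular cardinal `κ`. -/
lemma CategoryTheory.exists_isCardinalPresentable_of_small_family
    {D : Type u} [Category.{v} D] {ι : Type w} (X : ι → D) [∀ i, IsPresentable.{w} (X i)] :
    ∃ (κ : Cardinal.{w}) (_ : Fact κ.IsRegular), ∀ i, IsCardinalPresentable (X i) κ := by
  choose μ hμ hX using fun i ↦ Functor.IsAccessible.exists_cardinal.{w}
    (F := coyoneda.obj (Opposite.op (X i)))
  obtain ⟨κ, hκ, h⟩ := HasCardinalLT.exists_regular_cardinal_forall.{w} (fun i ↦ (μ i).out)
  have : Fact κ.IsRegular := ⟨hκ⟩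
  refine ⟨κ, this, fun i ↦ ?_⟩
  have : IsCardinalPresentable (X i) (μ i) := hX i
  have hle : μ i ≤ κ := by
    simpa [hasCardinalLT_iff_cardinal_mk_lt] using (h i).le
  exact isCardinalPresentable_of_le (X i) hle

/-- The category of copresheaves of types on a small category is locally presentable. -/
lemma CategoryTheory.isLocallyPresentable_functor_type (C : Type w) [SmallCategory C] :
    IsLocallyPresentable.{w} (C ⥤ Type w) :=
  (opOpEquivalence C).congrLeft.isLocallyPresentable

/-- In a cocomplete locally small category, the full subcategory
of local objects with respect to a small family of morphisms between presentable objects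
is reflective. -/
lemma CategoryTheory.MorphismProperty.isRightAdjoint_ι_isLocal_ofHoms
    {D : Type u} [Category.{v} D] [LocallySmall.{w} D] [HasColimitsOfSize.{w, w} D]
    {ι : Type w} {X Y : ι → D} [∀ i, IsPresentable.{w} (X i)] [∀ i, IsPresentable.{w} (Y i)]
    (h : ∀ i, X i ⟶ Y i) :
    (MorphismProperty.ofHoms h).isLocal.ι.IsRightAdjoint := by
  have (j : ι ⊕ ι) : IsPresentable.{w} (Sum.elim X Y j) := by
    cases j <;> dsimp <;> infer_instance
  obtain ⟨κ, _, hκ⟩ := exists_isCardinalPresentable_of_small_family (Sum.elim X Y)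
  refine MorphismProperty.isRightAdjoint_ι_isLocal _ κ ?_
  rintro _ _ _ ⟨i⟩
  exact ⟨hκ (.inl i), hκ (.inr i)⟩

lemma CategoryTheory.MorphismProperty.isLocal_ofHoms_iff
    {D : Type u} [Category.{v} D] {ι : Type*} {X Y : ι → D} (h : ∀ i, X i ⟶ Y i) (A : D) :
    (MorphismProperty.ofHoms h).isLocal A ↔
      ∀ (i : ι) (u : X i ⟶ A), ∃! v : Y i ⟶ A, h i ≫ v = u := by
  refine ⟨fun hA i u ↦ (hA _ ⟨i⟩).existsUnique u, ?_⟩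
  rintro hA _ _ _ ⟨i⟩
  exact (Function.bijective_iff_existsUnique _).2 (hA i)

/-- Existence of free models of cartesian theories: given a family of morphisms
`h i : X i ⟶ Y i` in `C ⥤ Type` with each `X i` pointwise finite, every `I : C ⥤ Type`
admits a free model, i.e. a strict model `A` (object orthogonal to every `h i`) with
`l : I ⟶ A` through which every morphism from `I` to a strict model factors uniquely. -/
theorem stmt_10 {C : Type} [SmallCategory C] [FinCategory C]
    {ι : Type} {X Y : ι → (C ⥤ Type)} (h : ∀ i, X i ⟶ Y i)
    (hX : ∀ (i : ι) (c : C), Finite ((X i).obj c))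
    (I : C ⥤ Type) :
    ∃ (A : C ⥤ Type) (l : I ⟶ A),
      (∀ (i : ι) (u : X i ⟶ A), ∃! v : Y i ⟶ A, h i ≫ v = u) ∧
      ∀ (B : C ⥤ Type), (∀ (i : ι) (u : X i ⟶ B), ∃! v : Y i ⟶ B, h i ≫ v = u) →
        ∀ b : I ⟶ B, ∃! g : A ⟶ B, l ≫ g = b := by
  have := isLocallyPresentable_functor_type C
  have := MorphismProperty.isRightAdjoint_ι_isLocal_ofHoms h
  let adj := Adjunction.ofIsRightAdjoint (MorphismProperty.ofHoms h).isLocal.ι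
  refine ⟨_, adj.unit.app I,
    (MorphismProperty.isLocal_ofHoms_iff h _).1 (ObjectProperty.FullSubcategory.property _),
    fun B hB b ↦ ?_⟩
  let B' : (MorphismProperty.ofHoms h).isLocal.FullSubcategory :=
    ⟨B, (MorphismProperty.isLocal_ofHoms_iff h B).2 hB⟩
  exact (((ObjectProperty.fullyFaithfulι _).homEquiv (Y := B')).symm.trans
    (adj.homEquiv I B')).bijective.existsUnique b
end

section
/- (An infinite free model.) Define f : ℕ → ℕ by f 0 = 0 and f n = n + 1 for n ≥ 1. Then f has exactly one fixed point, and for every type B, every function g : B → B having exactly one fixed point, and every element b ∈ B, there exists a unique function h : ℕ → B with h ∘ f = g ∘ h and h 1 = b. -/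
/-- The function `f : ℕ → ℕ` with `f 0 = 0` and `f n = n + 1` for `n ≥ 1`. -/
def chaseFun : ℕ → ℕ := fun n => if n = 0 then 0 else n + 1

@[simp]
theorem chaseFun_succ (n : ℕ) : chaseFun (n + 1) = n + 2 := rfl

/-- An infinite free model: `(ℕ, chaseFun)` with distinguished element `1` is a free
model of the cartesian theory `{∀x ∃! y. r(x,y), ∃! x. r(x,x)}` on `{foo}`. -/
theorem stmt_15 :
    (∃! x : ℕ, chaseFun x = x) ∧
    ∀ (B : Type) (g : B → B), (∃! x : B, g x = x) → ∀ b : B,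
      ∃! h : ℕ → B, h ∘ chaseFun = g ∘ h ∧ h 1 = b := by
  refine ⟨⟨0, rfl, ?_⟩, ?_⟩
  · rintro (_ | n) hn
    · rfl
    · simp at hn
  rintro B g ⟨c, hc, hc_unique⟩ b
  refine ⟨fun n => Nat.casesOn n c fun k => g^[k] b, ⟨?_, rfl⟩, ?_⟩
  · funext n
    cases n with
    | zero => exact hc.symm
    | succ k => exact Function.iterate_succ_apply' g k b
  · rintro h ⟨hcomm, h_one⟩
    funext n
    cases n with
    | zero => exact hc_unique _ (congrFun hcomm 0).symm
    | succ k =>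
      change h (k + 1) = g^[k] b
      induction k with
      | zero => exact h_one
      | succ k ih =>
        rw [Function.iterate_succ_apply', ← ih]
        exact congrFun hcomm (k + 1)
end
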